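/- arXiv:2403.04137 — 2 statements merged into one kernel-verified Lean document; each statement's English description precedes it below -/
import Mathlib

section
/- Let X be an infinite dimensional Banach space with the scalar-plus-compact property and consider c₀(X) with its standard shrinking Schauder decomposition. Then the quotient Banach algebra HA(c₀(X))/K(c₀(X)) is isometrically isomorphic as a Banach algebra to K(c₀). -/
open Filter Topology ZeroAtInfty

namespace ZeroSeq

section Basic

variable {X : Type*} [NormedAddCommGroup X]

theorem norm_apply_le (x : C₀(ℕ, X)) (i : ℕ) : ‖x i‖ ≤ ‖x‖ :=
  x.toBCF.norm_coe_le_norm i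

theorem norm_le {x : C₀(ℕ, X)} {C : ℝ} (hC : 0 ≤ C) : ‖x‖ ≤ C ↔ ∀ i, ‖x i‖ ≤ C :=
  BoundedContinuousFunction.norm_le (f := x.toBCF) hC

theorem finite_setOf_le_norm (x : C₀(ℕ, X)) {ε : ℝ} (hε : 0 < ε) : {i | ε ≤ ‖x i‖}.Finite := by
  have h := x.zero_at_infty'
  rw [cocompact_eq_cofinite, Metric.tendsto_nhds] at h
  have := h ε hε
  simp only [dist_zero_right, eventually_cofinite, not_lt] at this
  exact this

variable [NormedSpace ℂ X]

/-- The `i`-th coordinate functional on `C₀(ℕ, X)`. -/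
noncomputable def coord (i : ℕ) : C₀(ℕ, X) →L[ℂ] X :=
  LinearMap.mkContinuous
    { toFun := fun x => x i
      map_add' := fun _ _ => rfl
      map_smul' := fun _ _ => rfl } 1
    fun x => by simpa using norm_apply_le x i

@[simp]
theorem coord_apply (i : ℕ) (x : C₀(ℕ, X)) : coord i x = x i := rfl

@[simp]
theorem sum_apply {ι : Type*} (s : Finset ι) (f : ι → C₀(ℕ, X)) (i : ℕ) :
    (∑ j ∈ s, f j) i = ∑ j ∈ s, f j i :=
  map_sum (coord i) f s

/-- The unit vector basis of `c₀`. -/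
noncomputable def unitVec (j : ℕ) : C₀(ℕ, ℂ) where
  toFun i := if i = j then 1 else 0
  continuous_toFun := continuous_of_discreteTopology
  zero_at_infty' := by
    rw [cocompact_eq_cofinite]
    refine tendsto_const_nhds.congr' ?_
    filter_upwards [(Set.finite_singleton j).compl_mem_cofinite] with i hi
    exact (if_neg hi).symm

theorem unitVec_apply (j i : ℕ) : unitVec j i = if i = j then 1 else 0 :=
  rfl

/-- The elementary tensor `v ⊗ u`, that is, the sequence `i ↦ v i • u`. -/
noncomputable def tensor : C₀(ℕ, ℂ) →L[ℂ] X →L[ℂ] C₀(ℕ, X) :=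
  LinearMap.mkContinuous₂
    (LinearMap.mk₂ ℂ
      (fun v u =>
        { toFun := fun i => v i • u
          continuous_toFun := continuous_of_discreteTopology
          zero_at_infty' := by simpa using v.zero_at_infty'.smul_const u })
      (fun _ _ _ => by ext i; simp [add_smul])
      (fun _ _ _ => by ext i; simp [mul_smul])
      (fun _ _ _ => by ext i; simp)
      (fun c v u => by ext i; simp [smul_comm c]))
    1 fun v u => by
      rw [one_mul, norm_le (by positivity)]
      intro i
      change ‖v i • u‖ ≤ _
      rw [norm_smul]
      gcongr
      exact norm_apply_le v i

@[simp]
theorem tensor_apply (v : C₀(ℕ, ℂ)) (u : X) (i : ℕ) : tensor v u i = v i • u := rfl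

theorem norm_tensor (v : C₀(ℕ, ℂ)) (u : X) : ‖tensor v u‖ = ‖v‖ * ‖u‖ := by
  apply le_antisymm
  · rw [norm_le (by positivity)]
    intro i
    rw [tensor_apply, norm_smul]
    gcongr
    exact norm_apply_le v i
  · rcases eq_or_ne u 0 with rfl | hu
    · simp
    have hu : 0 < ‖u‖ := norm_pos_iff.2 hu
    rw [← le_div_iff₀ hu, norm_le (by positivity)]
    intro i
    rw [le_div_iff₀ hu, ← norm_smul, ← tensor_apply]
    exact norm_apply_le _ i

theorem sum_tensor_unitVec_apply (s : Finset ℕ) (x : ℕ → X) (i : ℕ) :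
    (∑ j ∈ s, tensor (unitVec j) (x j)) i = if i ∈ s then x i else 0 := by
  simp [unitVec_apply, ite_smul]

theorem norm_sum_tensor_unitVec_le (s : Finset ℕ) (x : ℕ → X) {C : ℝ} (hC : 0 ≤ C)
    (h : ∀ j ∈ s, ‖x j‖ ≤ C) : ‖∑ j ∈ s, tensor (unitVec j) (x j)‖ ≤ C := by
  rw [norm_le hC]
  intro i
  rw [sum_tensor_unitVec_apply]
  split_ifs with hi
  · exact h i hi
  · simpa using hC

theorem hasSum_tensor_unitVec (x : C₀(ℕ, X)) :
    HasSum (fun j => tensor (unitVec j) (x j)) x := by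
  rw [HasSum, SummationFilter.unconditional_filter, Metric.tendsto_atTop]
  intro ε hε
  refine ⟨(finite_setOf_le_norm x (half_pos hε)).toFinset, fun s hs => ?_⟩
  rw [dist_eq_norm]
  refine lt_of_le_of_lt ((norm_le (half_pos hε).le).2 fun i => ?_) (half_lt_self hε)
  rw [ZeroAtInftyContinuousMap.sub_apply, sum_tensor_unitVec_apply]
  split_ifs with hi
  · simpa using (half_pos hε).le
  · rw [zero_sub, norm_neg]
    by_contra h
    exact hi (hs (by simpa using (not_le.1 h).le))

theorem smul_unitVec (c : ℂ) (j : ℕ) : c • unitVec j = tensor (unitVec j) c := by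
  ext i
  simp [mul_comm]

theorem clm_ext {Y : Type*} [NormedAddCommGroup Y] [NormedSpace ℂ Y]
    {A B : C₀(ℕ, X) →L[ℂ] Y}
    (h : ∀ v u, A (tensor v u) = B (tensor v u)) : A = B := by
  ext x
  have hx := hasSum_tensor_unitVec x
  refine (hx.mapL A).unique ?_
  simpa only [h] using hx.mapL B

/-- The projection of `C₀(ℕ, X)` onto the first `n` coordinates. -/
noncomputable def proj (n : ℕ) : C₀(ℕ, X) →L[ℂ] C₀(ℕ, X) :=
  ∑ j ∈ Finset.range n, (tensor (unitVec j)).comp (coord j)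

theorem proj_eq_sum (n : ℕ) (x : C₀(ℕ, X)) :
    proj n x = ∑ j ∈ Finset.range n, tensor (unitVec j) (x j) := by
  simp [proj]

theorem proj_apply (n : ℕ) (x : C₀(ℕ, X)) (i : ℕ) : proj n x i = if i < n then x i else 0 := by
  rw [proj_eq_sum, sum_tensor_unitVec_apply]
  simp

theorem norm_proj_le (n : ℕ) : ‖(proj n : C₀(ℕ, X) →L[ℂ] C₀(ℕ, X))‖ ≤ 1 := by
  refine ContinuousLinearMap.opNorm_le_bound _ zero_le_one fun x => ?_
  rw [proj_eq_sum, one_mul]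
  exact norm_sum_tensor_unitVec_le _ _ (norm_nonneg x) fun j _ => norm_apply_le x j

theorem tendsto_proj (x : C₀(ℕ, X)) : Tendsto (fun n => proj n x) atTop (𝓝 x) := by
  simpa only [proj_eq_sum] using (hasSum_tensor_unitVec x).tendsto_sum_nat

theorem proj_tensor (n : ℕ) (v : C₀(ℕ, ℂ)) (u : X) :
    proj n (tensor v u) = tensor (proj n v) u := by
  ext i
  simp only [proj_apply, tensor_apply]
  split_ifs <;> simp

end Basic

section Compact

/-- A compact operator on an infinite-dimensional Banach space is not bounded below. -/
theorem exists_norm_eq_one_norm_lt {X Y : Type*} [NormedAddCommGroup X] [NormedSpace ℂ X]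
    [CompleteSpace X] [NormedAddCommGroup Y] [NormedSpace ℂ Y]
    (hinf : ¬ FiniteDimensional ℂ X) (K : X →L[ℂ] Y) (hK : IsCompactOperator ⇑K)
    {ε : ℝ} (hε : 0 < ε) : ∃ u : X, ‖u‖ = 1 ∧ ‖K u‖ < ε := by
  by_contra! h
  apply hinf
  have hb : ∀ x, ‖x‖ ≤ (⟨ε⁻¹, (inv_pos.2 hε).le⟩ : NNReal) * ‖K x‖ := by
    intro x
    rcases eq_or_ne x 0 with rfl | hx
    · simp
    have h1 := h ((‖x‖⁻¹ : ℂ) • x) (by simp [norm_smul, hx])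
    rw [map_smul, norm_smul, norm_inv, Complex.norm_real, norm_norm,
      le_inv_mul_iff₀ (norm_pos_iff.2 hx)] at h1
    change ‖x‖ ≤ ε⁻¹ * _
    rw [le_inv_mul_iff₀ hε]
    linarith
  have hemb := (K.antilipschitz_of_bound hb).isClosedEmbedding K.uniformContinuous
  obtain ⟨C, hC, hsub⟩ := hK.image_closedBall_subset_compact (f := K.toLinearMap) 1
  refine FiniteDimensional.of_isCompact_closedBall ℂ one_pos (c := 0) ?_
  exact (hemb.isCompact_preimage hC).of_isClosed_subset Metric.isClosed_closedBall
    (Set.image_subset_iff.1 hsub)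

theorem isCompactOperator_smulRight {X Y : Type*} [NormedAddCommGroup X] [NormedSpace ℂ X]
    [NormedAddCommGroup Y] [NormedSpace ℂ Y] (φ : X →L[ℂ] ℂ) (y : Y) :
    IsCompactOperator ⇑(φ.smulRight y) :=
  (isCompactOperator_of_locallyCompactSpace_rng
    (ContinuousLinearMap.toSpanSingleton ℂ y)).comp_clm φ

theorem tendsto_comp_of_isCompactOperator {X Y : Type*} [NormedAddCommGroup X] [NormedSpace ℂ X]
    [NormedAddCommGroup Y] [NormedSpace ℂ Y] {Q : ℕ → Y →L[ℂ] Y} (hQ : ∀ n, ‖Q n‖ ≤ 1)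
    (hlim : ∀ y, Tendsto (fun n => Q n y) atTop (𝓝 y)) {T : X →L[ℂ] Y}
    (hT : IsCompactOperator ⇑T) : Tendsto (fun n => (Q n).comp T) atTop (𝓝 T) := by
  obtain ⟨C, hC, hsub⟩ := hT.image_closedBall_subset_compact (f := T.toLinearMap) 1
  rw [Metric.tendsto_nhds]
  intro ε hε
  obtain ⟨t, ht, hcov⟩ :=
    Metric.totallyBounded_iff.1 hC.totallyBounded (ε / 4) (by positivity)
  have hev : ∀ᶠ n in atTop, ∀ y ∈ t, dist (Q n y) y < ε / 4 :=
    (eventually_all_finite ht).2 fun y _ => Metric.tendsto_nhds.1 (hlim y) _ (by positivity)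
  filter_upwards [hev] with n hn
  rw [dist_eq_norm]
  refine lt_of_le_of_lt (ContinuousLinearMap.opNorm_le_of_unit_norm (C := 3 * (ε / 4))
    (by positivity) fun x hx => ?_) (by linarith)
  have hx' : T x ∈ C := hsub ⟨x, by simp [hx], rfl⟩
  obtain ⟨y, hy, hxy⟩ := Set.mem_iUnion₂.1 (hcov hx')
  have h1 : dist (Q n (T x)) (Q n y) ≤ dist (T x) y := by
    rw [dist_eq_norm, dist_eq_norm, ← map_sub]
    simpa using (Q n).le_of_opNorm_le (hQ n) (T x - y)
  have h2 := hn y hy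
  rw [Metric.mem_ball] at hxy
  have := dist_triangle4 (Q n (T x)) (Q n y) y (T x)
  rw [dist_comm y] at this
  simp only [_root_.sub_apply, ContinuousLinearMap.comp_apply, ← dist_eq_norm]
  linarith

end Compact

section Approx

theorem sum_norm_apply_unitVec_le (φ : C₀(ℕ, ℂ) →L[ℂ] ℂ) (s : Finset ℕ) :
    ∑ j ∈ s, ‖φ (unitVec j)‖ ≤ ‖φ‖ := by
  choose a ha ha' using fun j => Complex.exists_norm_eq_mul_self (φ (unitVec j))
  have h1 : ‖∑ j ∈ s, tensor (unitVec j) (a j)‖ ≤ 1 :=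
    norm_sum_tensor_unitVec_le s a zero_le_one fun j _ => (ha j).le
  have h2 : φ (∑ j ∈ s, tensor (unitVec j) (a j)) = ((∑ j ∈ s, ‖φ (unitVec j)‖ : ℝ) : ℂ) := by
    simp [← smul_unitVec, ha']
  calc ∑ j ∈ s, ‖φ (unitVec j)‖ = ‖φ (∑ j ∈ s, tensor (unitVec j) (a j))‖ := by
        rw [h2, Complex.norm_real, Real.norm_of_nonneg (by positivity)]
    _ ≤ ‖φ‖ * 1 := φ.le_opNorm_of_le h1
    _ = ‖φ‖ := mul_one _

theorem tendsto_functional_comp_proj (φ : C₀(ℕ, ℂ) →L[ℂ] ℂ) :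
    Tendsto (fun n => φ.comp (proj n)) atTop (𝓝 φ) := by
  have hs : Summable fun j => ‖φ (unitVec j)‖ :=
    summable_of_sum_le (fun _ => norm_nonneg _) (sum_norm_apply_unitVec_le φ)
  refine (tendsto_iff_norm_sub_tendsto_zero (E := C₀(ℕ, ℂ) →L[ℂ] ℂ)).2 ?_
  refine squeeze_zero (fun n => norm_nonneg (φ.comp (proj n) - φ)) (fun n => ?_)
    (tendsto_sum_nat_add fun j => ‖φ (unitVec j)‖)
  refine ContinuousLinearMap.opNorm_le_bound _ (tsum_nonneg fun _ => norm_nonneg _) fun x => ?_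
  have hx := ((hasSum_nat_add_iff' n).2 (hasSum_tensor_unitVec x)).mapL φ
  rw [← proj_eq_sum] at hx
  rw [← norm_neg, _root_.sub_apply, ContinuousLinearMap.comp_apply, neg_sub,
    ← map_sub, ← hx.tsum_eq]
  refine tsum_of_norm_bounded (((summable_nat_add_iff n).2 hs).hasSum.mul_right ‖x‖) fun j => ?_
  rw [← smul_unitVec, map_smul, norm_smul, mul_comm]
  gcongr
  exact norm_apply_le _ _

theorem tendsto_proj_comp_comp_proj {T : C₀(ℕ, ℂ) →L[ℂ] C₀(ℕ, ℂ)} (hT : IsCompactOperator ⇑T) :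
    Tendsto (fun n => ((proj n).comp T).comp (proj n)) atTop (𝓝 T) := by
  have hleft := tendsto_comp_of_isCompactOperator norm_proj_le tendsto_proj hT
  have hright (m : ℕ) :
      Tendsto (fun n => ((proj m).comp T).comp (proj n)) atTop (𝓝 ((proj m).comp T)) := by
    have h (B : C₀(ℕ, ℂ) →L[ℂ] C₀(ℕ, ℂ)) : (proj m).comp B =
        ∑ j ∈ Finset.range m, (tensor (unitVec j)).comp ((coord j).comp B) := by
      ext1 x
      simp [proj_eq_sum]
    simp only [ContinuousLinearMap.comp_assoc]
    simp only [h]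
    refine tendsto_finsetSum _ fun j _ => ?_
    exact ((continuous_const.clm_comp continuous_id).tendsto _).comp
      (tendsto_functional_comp_proj ((coord j).comp T))
  rw [Metric.tendsto_atTop] at hleft
  refine (Metric.tendsto_atTop (α := C₀(ℕ, ℂ) →L[ℂ] C₀(ℕ, ℂ))).2 ?_
  intro ε hε
  obtain ⟨M, hM⟩ := hleft (ε / 4) (by positivity)
  obtain ⟨N, hN⟩ := (Metric.tendsto_atTop (α := C₀(ℕ, ℂ) →L[ℂ] C₀(ℕ, ℂ))).1 (hright M) (ε / 4) (by positivity)
  refine ⟨max M N, fun n hn => ?_⟩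
  have hcomp (A B : C₀(ℕ, ℂ) →L[ℂ] C₀(ℕ, ℂ)) :
      dist (A.comp (proj n)) (B.comp (proj n)) ≤ dist A B := by
    rw [dist_eq_norm A B, dist_eq_norm (A.comp (proj n)) (B.comp (proj n)),
      ← ContinuousLinearMap.sub_comp]
    exact (ContinuousLinearMap.opNorm_comp_le _ _).trans
      (mul_le_of_le_one_right (norm_nonneg _) (norm_proj_le n))
  have h1 := hM n (le_of_max_le_left hn)
  have h2 := hM M le_rfl
  have h3 := hN n (le_of_max_le_right hn)
  have h4 := hcomp ((proj n).comp T) T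
  have h5 := hcomp T ((proj M).comp T)
  rw [dist_comm T] at h5
  have h6 := dist_triangle4 (((proj n).comp T).comp (proj n)) (T.comp (proj n))
    (((proj M).comp T).comp (proj n)) ((proj M).comp T)
  have h7 := dist_triangle (((proj n).comp T).comp (proj n)) ((proj M).comp T) T
  linarith

end Approx

section Ampliation

variable {X : Type*} [NormedAddCommGroup X] [NormedSpace ℂ X]

theorem norm_sum_tensor_le (T : C₀(ℕ, ℂ) →L[ℂ] C₀(ℕ, ℂ)) (s : Finset ℕ) (x : ℕ → X) {C : ℝ}
    (hC : 0 ≤ C) (h : ∀ j ∈ s, ‖x j‖ ≤ C) :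
    ‖∑ j ∈ s, tensor (T (unitVec j)) (x j)‖ ≤ ‖T‖ * C := by
  rw [norm_le (by positivity)]
  intro i
  rw [sum_apply]
  obtain ⟨g, hg, hgy⟩ := exists_dual_vector'' ℂ (∑ j ∈ s, tensor (T (unitVec j)) (x j) i)
  have hnorm : ‖∑ j ∈ s, tensor (unitVec j) (g (x j))‖ ≤ C :=
    norm_sum_tensor_unitVec_le s _ hC fun j hj =>
      (g.le_of_opNorm_le hg _).trans (by simpa using h j hj)
  have heq : g (∑ j ∈ s, tensor (T (unitVec j)) (x j) i) =
      T (∑ j ∈ s, tensor (unitVec j) (g (x j))) i := by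
    simp [← smul_unitVec, mul_comm]
  have := (norm_apply_le _ i).trans (T.le_opNorm_of_le hnorm)
  rwa [← heq, hgy, RCLike.norm_ofReal, abs_norm] at this

variable [CompleteSpace X]

theorem summable_tensor (T : C₀(ℕ, ℂ) →L[ℂ] C₀(ℕ, ℂ)) (x : C₀(ℕ, X)) :
    Summable fun j => tensor (T (unitVec j)) (x j) := by
  rw [summable_iff_vanishing_norm]
  intro ε hε
  set δ := ε / (‖T‖ + 1) with hδ
  have hδ0 : 0 < δ := by positivity
  refine ⟨(finite_setOf_le_norm x hδ0).toFinset, fun t ht => ?_⟩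
  refine (norm_sum_tensor_le T t x hδ0.le fun j hj => ?_).trans_lt ?_
  · by_contra h
    exact Finset.disjoint_left.1 ht hj (by simpa using (not_le.1 h).le)
  · rw [hδ, mul_div_assoc', div_lt_iff₀ (by positivity)]
    nlinarith

/-- The ampliation `T ⊗ I` of an operator `T` on `c₀` to `c₀(X)`. -/
noncomputable def ampliation (T : C₀(ℕ, ℂ) →L[ℂ] C₀(ℕ, ℂ)) : C₀(ℕ, X) →L[ℂ] C₀(ℕ, X) :=
  LinearMap.mkContinuous
    { toFun := fun x => ∑' j, tensor (T (unitVec j)) (x j)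
      map_add' := fun x y => by
        rw [← (summable_tensor T x).tsum_add (summable_tensor T y)]
        simp
      map_smul' := fun c x => by
        rw [RingHom.id_apply, ← (summable_tensor T x).tsum_const_smul]
        simp }
    ‖T‖ fun x => le_of_tendsto (summable_tensor T x).hasSum.norm
      (.of_forall fun s => norm_sum_tensor_le T s x (norm_nonneg x) fun j _ => norm_apply_le x j)

theorem norm_ampliation_le (T : C₀(ℕ, ℂ) →L[ℂ] C₀(ℕ, ℂ)) :
    ‖(ampliation T : C₀(ℕ, X) →L[ℂ] C₀(ℕ, X))‖ ≤ ‖T‖ :=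
  LinearMap.mkContinuous_norm_le _ (norm_nonneg T) _

@[simp]
theorem ampliation_tensor (T : C₀(ℕ, ℂ) →L[ℂ] C₀(ℕ, ℂ)) (v : C₀(ℕ, ℂ)) (u : X) :
    ampliation T (tensor v u) = tensor (T v) u := by
  have h := (hasSum_tensor_unitVec v).mapL ((tensor.flip u : C₀(ℕ, ℂ) →L[ℂ] C₀(ℕ, X)).comp T)
  refine (summable_tensor T (tensor v u)).hasSum.unique ?_
  simpa [← smul_unitVec] using h

theorem ampliation_add (S T : C₀(ℕ, ℂ) →L[ℂ] C₀(ℕ, ℂ)) :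
    (ampliation (S + T) : C₀(ℕ, X) →L[ℂ] C₀(ℕ, X)) = ampliation S + ampliation T :=
  clm_ext fun v u => by simp

theorem ampliation_smul (c : ℂ) (T : C₀(ℕ, ℂ) →L[ℂ] C₀(ℕ, ℂ)) :
    (ampliation (c • T) : C₀(ℕ, X) →L[ℂ] C₀(ℕ, X)) = c • ampliation T :=
  clm_ext fun v u => by simp

theorem ampliation_sub (S T : C₀(ℕ, ℂ) →L[ℂ] C₀(ℕ, ℂ)) :
    (ampliation (S - T) : C₀(ℕ, X) →L[ℂ] C₀(ℕ, X)) = ampliation S - ampliation T :=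
  clm_ext fun v u => by simp

theorem ampliation_comp (S T : C₀(ℕ, ℂ) →L[ℂ] C₀(ℕ, ℂ)) :
    (ampliation (S.comp T) : C₀(ℕ, X) →L[ℂ] C₀(ℕ, X)) = (ampliation S).comp (ampliation T) :=
  clm_ext fun v u => by simp

theorem ampliation_proj (n : ℕ) :
    (ampliation (proj n) : C₀(ℕ, X) →L[ℂ] C₀(ℕ, X)) = proj n :=
  clm_ext fun v u => by rw [ampliation_tensor, proj_tensor]

theorem tendsto_ampliation {T : ℕ → C₀(ℕ, ℂ) →L[ℂ] C₀(ℕ, ℂ)} {S : C₀(ℕ, ℂ) →L[ℂ] C₀(ℕ, ℂ)}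
    (h : Tendsto T atTop (𝓝 S)) :
    Tendsto (fun n => (ampliation (T n) : C₀(ℕ, X) →L[ℂ] C₀(ℕ, X))) atTop
      (𝓝 (ampliation S)) := by
  refine (tendsto_iff_norm_sub_tendsto_zero (E := C₀(ℕ, X) →L[ℂ] C₀(ℕ, X))).2 ?_
  refine squeeze_zero (fun n => norm_nonneg (E := C₀(ℕ, X) →L[ℂ] C₀(ℕ, X)) _)
    (fun n => ?_) ((tendsto_iff_norm_sub_tendsto_zero (E := C₀(ℕ, ℂ) →L[ℂ] C₀(ℕ, ℂ))).1 h)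
  rw [← ampliation_sub]
  exact norm_ampliation_le _

theorem norm_le_norm_ampliation_add (hinf : ¬ FiniteDimensional ℂ X)
    (T : C₀(ℕ, ℂ) →L[ℂ] C₀(ℕ, ℂ)) {K : C₀(ℕ, X) →L[ℂ] C₀(ℕ, X)} (hK : IsCompactOperator ⇑K) :
    ‖T‖ ≤ ‖ampliation T + K‖ := by
  refine ContinuousLinearMap.opNorm_le_bound _ (norm_nonneg (ampliation T + K)) fun v => ?_
  refine le_of_forall_pos_le_add fun ε hε => ?_
  obtain ⟨u, hu, hKu⟩ :=
    exists_norm_eq_one_norm_lt hinf (K.comp (tensor v)) (hK.comp_clm (tensor v)) hε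
  have h1 := (ampliation T + K).le_opNorm (tensor v u)
  rw [norm_tensor, hu, mul_one, _root_.add_apply, ampliation_tensor] at h1
  have h2 := norm_sub_le (tensor (T v) u + K (tensor v u)) (K (tensor v u))
  rw [add_sub_cancel_right, norm_tensor, hu, mul_one] at h2
  rw [ContinuousLinearMap.comp_apply] at hKu
  linarith

end Ampliation

section Symbol

variable {X : Type*} [NormedAddCommGroup X] [NormedSpace ℂ X] [CompleteSpace X]

/-- `T` is a symbol of `A` if `T` is compact and `A` is a compact perturbation of `T ⊗ I`. -/
def IsSymbol (A : C₀(ℕ, X) →L[ℂ] C₀(ℕ, X)) (T : C₀(ℕ, ℂ) →L[ℂ] C₀(ℕ, ℂ)) : Prop :=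
  IsCompactOperator ⇑T ∧ IsCompactOperator ⇑(A - ampliation T : C₀(ℕ, X) →L[ℂ] C₀(ℕ, X))

namespace IsSymbol

variable {A B : C₀(ℕ, X) →L[ℂ] C₀(ℕ, X)} {S T : C₀(ℕ, ℂ) →L[ℂ] C₀(ℕ, ℂ)}

theorem ampliation (hT : IsCompactOperator ⇑T) :
    IsSymbol (X := X) (ampliation T) T :=
  ⟨hT, by rw [sub_self]; exact isCompactOperator_zero⟩

theorem zero_iff : IsSymbol A 0 ↔ IsCompactOperator ⇑A := by
  have h : (ZeroSeq.ampliation 0 : C₀(ℕ, X) →L[ℂ] C₀(ℕ, X)) = 0 := clm_ext fun v u => by simp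
  rw [IsSymbol, h, sub_zero]
  exact and_iff_right isCompactOperator_zero

theorem add (hA : IsSymbol A T) (hB : IsSymbol B S) : IsSymbol (A + B) (T + S) := by
  refine ⟨hA.1.add hB.1, ?_⟩
  rw [ampliation_add, add_sub_add_comm]
  exact hA.2.add hB.2

theorem smul (c : ℂ) (hA : IsSymbol A T) : IsSymbol (c • A) (c • T) := by
  refine ⟨hA.1.smul c, ?_⟩
  have h : c • A - ZeroSeq.ampliation (c • T) = c • (A - ZeroSeq.ampliation T) := by
    rw [ampliation_smul]
    exact (smul_sub c A _).symm
  rw [h]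
  exact hA.2.smul c

theorem sum {ι : Type*} (s : Finset ι) {A : ι → C₀(ℕ, X) →L[ℂ] C₀(ℕ, X)}
    {T : ι → C₀(ℕ, ℂ) →L[ℂ] C₀(ℕ, ℂ)} (h : ∀ i ∈ s, IsSymbol (A i) (T i)) :
    IsSymbol (∑ i ∈ s, A i) (∑ i ∈ s, T i) := by
  classical
  induction s using Finset.induction_on with
  | empty => simpa using zero_iff.2 isCompactOperator_zero
  | insert i s hi ih =>
    rw [Finset.sum_insert hi, Finset.sum_insert hi]
    exact (h i (by simp)).add (ih fun j hj => h j (by simp [hj]))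

theorem comp (hA : IsSymbol A T) (hB : IsSymbol B S) : IsSymbol (A.comp B) (T.comp S) := by
  refine ⟨hA.1.comp_clm S, ?_⟩
  have h : A.comp B - ZeroSeq.ampliation (T.comp S) =
      (A - ZeroSeq.ampliation T).comp B +
        (ZeroSeq.ampliation T).comp (B - ZeroSeq.ampliation S) := by
    rw [ampliation_comp, ContinuousLinearMap.sub_comp, ContinuousLinearMap.comp_sub]
    abel
  rw [h]
  exact (hA.2.comp_clm B).add (hB.2.clm_comp (ZeroSeq.ampliation T))

theorem norm_le (hinf : ¬ FiniteDimensional ℂ X) (hA : IsSymbol A T)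
    {K : C₀(ℕ, X) →L[ℂ] C₀(ℕ, X)} (hK : IsCompactOperator ⇑K) : ‖T‖ ≤ ‖A - K‖ := by
  have h : A - K = ZeroSeq.ampliation T + (A - ZeroSeq.ampliation T - K) := by abel
  rw [h]
  exact norm_le_norm_ampliation_add hinf T (hA.2.sub hK)

theorem sub (hA : IsSymbol A T) (hB : IsSymbol B S) : IsSymbol (A - B) (T - S) := by
  refine ⟨hA.1.sub hB.1, ?_⟩
  rw [ampliation_sub, sub_sub_sub_comm]
  exact hA.2.sub hB.2

theorem norm_sub_le (hinf : ¬ FiniteDimensional ℂ X) (hA : IsSymbol A T) (hB : IsSymbol B S) :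
    ‖T - S‖ ≤ ‖A - B‖ := by
  simpa using (hA.sub hB).norm_le hinf (K := 0) isCompactOperator_zero

theorem unique (hinf : ¬ FiniteDimensional ℂ X) (hA : IsSymbol A T) (hB : IsSymbol A S) :
    T = S := by
  have h := hA.norm_sub_le hinf hB
  rw [sub_self] at h
  exact sub_eq_zero.1 (norm_le_zero_iff.1 (h.trans_eq ContinuousLinearMap.opNorm_zero))

theorem norm_eq_sInf (hinf : ¬ FiniteDimensional ℂ X) (hA : IsSymbol A T) :
    ‖T‖ = sInf {r : ℝ | ∃ K : C₀(ℕ, X) →L[ℂ] C₀(ℕ, X),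
      IsCompactOperator ⇑K ∧ r = ‖A - K‖} := by
  have hmem : ‖T‖ = ‖A - (A - ZeroSeq.ampliation T)‖ := by
    refine le_antisymm (hA.norm_le hinf hA.2) ?_
    rw [sub_sub_cancel]
    exact norm_ampliation_le T
  symm
  refine IsLeast.csInf_eq (s := {r : ℝ | ∃ K : C₀(ℕ, X) →L[ℂ] C₀(ℕ, X),
    IsCompactOperator ⇑K ∧ r = ‖A - K‖}) ⟨⟨_, hA.2, hmem⟩, ?_⟩
  rintro _ ⟨K, hK, rfl⟩
  exact hA.norm_le hinf hK

theorem exists_of_tendsto (hinf : ¬ FiniteDimensional ℂ X)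
    {A : ℕ → C₀(ℕ, X) →L[ℂ] C₀(ℕ, X)} (hA : ∀ n, ∃ T, IsSymbol (A n) T)
    (hlim : Tendsto A atTop (𝓝 B)) : ∃ T, IsSymbol B T := by
  choose T hT using hA
  have hcauchy : CauchySeq T := by
    refine (Metric.cauchySeq_iff (α := C₀(ℕ, ℂ) →L[ℂ] C₀(ℕ, ℂ))).2 fun ε hε => ?_
    obtain ⟨N, hN⟩ := (Metric.cauchySeq_iff (α := C₀(ℕ, X) →L[ℂ] C₀(ℕ, X))).1 hlim.cauchySeq ε hε
    refine ⟨N, fun m hm n hn => lt_of_le_of_lt ?_ (hN m hm n hn)⟩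
    exact (dist_eq_norm (T m) (T n)).trans_le <| ((hT m).norm_sub_le hinf (hT n)).trans_eq
      (dist_eq_norm (A m) (A n)).symm
  obtain ⟨S, hS⟩ := cauchySeq_tendsto_of_complete hcauchy
  refine ⟨S, isCompactOperator_of_tendsto hS (.of_forall fun n => (hT n).1), ?_⟩
  exact isCompactOperator_of_tendsto (hlim.sub (tendsto_ampliation hS))
    (.of_forall fun n => (hT n).2)

end IsSymbol

theorem exists_isSymbol_matrixUnit
    (hspc : ∀ T : X →L[ℂ] X, ∃ (c : ℂ) (K : X →L[ℂ] X),
      IsCompactOperator ⇑K ∧ T = c • ContinuousLinearMap.id ℂ X + K)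
    (B : X →L[ℂ] X) (i j : ℕ) :
    ∃ T, IsSymbol ((tensor (unitVec i)).comp (B.comp (coord j))) T := by
  obtain ⟨c, K, hK, rfl⟩ := hspc B
  refine ⟨(coord j).smulRight (c • unitVec i), isCompactOperator_smulRight _ _, ?_⟩
  have h : (tensor (unitVec i)).comp
        ((c • ContinuousLinearMap.id ℂ X + K).comp (coord j)) -
      ampliation ((coord j).smulRight (c • unitVec i)) =
      (tensor (unitVec i)).comp (K.comp (coord j)) := by
    refine clm_ext fun v u => ?_
    ext k
    simp [smul_smul, mul_comm]
  rw [h]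
  exact (hK.comp_clm (coord j)).clm_comp (tensor (unitVec i))

theorem exists_isSymbol (hinf : ¬ FiniteDimensional ℂ X)
    (hspc : ∀ T : X →L[ℂ] X, ∃ (c : ℂ) (K : X →L[ℂ] X),
      IsCompactOperator ⇑K ∧ T = c • ContinuousLinearMap.id ℂ X + K)
    {A : C₀(ℕ, X) →L[ℂ] C₀(ℕ, X)}
    (hA : Tendsto (fun n => ((proj n).comp A).comp (proj n)) atTop (𝓝 A)) :
    ∃ T, IsSymbol A T := by
  refine IsSymbol.exists_of_tendsto hinf (fun n => ?_) hA
  choose T hT using fun i j =>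
    exists_isSymbol_matrixUnit hspc ((coord i).comp (A.comp (tensor (unitVec j)))) i j
  refine ⟨∑ i ∈ Finset.range n, ∑ j ∈ Finset.range n, T i j, ?_⟩
  have h : ((proj n).comp A).comp (proj n) =
      ∑ i ∈ Finset.range n, ∑ j ∈ Finset.range n, (tensor (unitVec i)).comp
        (((coord i).comp (A.comp (tensor (unitVec j)))).comp (coord j)) := by
    ext1 x
    rw [Finset.sum_comm]
    simp [proj_eq_sum]
  rw [h]
  exact IsSymbol.sum _ fun i _ => IsSymbol.sum _ fun j _ => hT i j

theorem tendsto_proj_comp_ampliation {T : C₀(ℕ, ℂ) →L[ℂ] C₀(ℕ, ℂ)} (hT : IsCompactOperator ⇑T) :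
    Tendsto (fun n => ((proj n).comp (ampliation T : C₀(ℕ, X) →L[ℂ] C₀(ℕ, X))).comp (proj n)) atTop
      (𝓝 (ampliation T)) := by
  simpa only [ampliation_comp, ampliation_proj] using
    tendsto_ampliation (X := X) (tendsto_proj_comp_comp_proj hT)

end Symbol

end ZeroSeq

open ZeroSeq in
/-- Let `X` be an infinite dimensional Banach space with the scalar-plus-compact
property and consider `c₀(X)` with its standard (shrinking) Schauder decomposition, with
projections `P n`. Then the quotient Banach algebra `HA(c₀(X))/K(c₀(X))` is isometrically
isomorphic as a Banach algebra to `K(c₀)`: there is a map `Φ` defined on the horizontally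
approximable operators, vanishing exactly on the compact ones, which is an algebra
homomorphism modulo nothing (exactly), is a quotient-isometry (`‖Φ A‖` equals the distance of
`A` to the compact operators), and is onto the compact operators on `c₀`. -/
theorem stmt7 (X : Type*) [NormedAddCommGroup X] [NormedSpace ℂ X] [CompleteSpace X]
    (hinf : ¬ FiniteDimensional ℂ X)
    (hspc : ∀ T : X →L[ℂ] X, ∃ (c : ℂ) (K : X →L[ℂ] X),
      IsCompactOperator ⇑K ∧ T = c • ContinuousLinearMap.id ℂ X + K)
    (P : ℕ → C₀(ℕ, X) →L[ℂ] C₀(ℕ, X))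
    (hP : ∀ (n : ℕ) (x : C₀(ℕ, X)) (k : ℕ), P n x k = if k ≤ n then x k else 0)
    (HA : Set (C₀(ℕ, X) →L[ℂ] C₀(ℕ, X)))
    (hHA : HA = {A | Tendsto (fun n => ((P n).comp A).comp (P n)) atTop (𝓝 A)}) :
    ∃ Φ : (C₀(ℕ, X) →L[ℂ] C₀(ℕ, X)) → (C₀(ℕ, ℂ) →L[ℂ] C₀(ℕ, ℂ)),
      (∀ A ∈ HA, IsCompactOperator ⇑(Φ A)) ∧
      (∀ A ∈ HA, ∀ B ∈ HA, Φ (A + B) = Φ A + Φ B ∧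
        (∀ c : ℂ, Φ (c • A) = c • Φ A) ∧ Φ (A.comp B) = (Φ A).comp (Φ B)) ∧
      (∀ A ∈ HA, ‖Φ A‖ =
        sInf {r : ℝ | ∃ K : C₀(ℕ, X) →L[ℂ] C₀(ℕ, X),
          IsCompactOperator ⇑K ∧ r = ‖A - K‖}) ∧
      (∀ A ∈ HA, (Φ A = 0 ↔ IsCompactOperator ⇑A)) ∧
      (∀ T : C₀(ℕ, ℂ) →L[ℂ] C₀(ℕ, ℂ), IsCompactOperator ⇑T →
        ∃ A ∈ HA, Φ A = T) := by
  classical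
  have hPn (n : ℕ) : P n = proj (n + 1) := by
    ext x k
    rw [hP, proj_apply]
    simp only [Nat.lt_succ_iff]
  have hHA' (A : C₀(ℕ, X) →L[ℂ] C₀(ℕ, X)) :
      A ∈ HA ↔ Tendsto (fun n => ((proj n).comp A).comp (proj n)) atTop (𝓝 A) := by
    rw [hHA, ← tendsto_add_atTop_iff_nat 1]
    simp only [Set.mem_ofPred_eq, hPn]
  have hex : ∀ A ∈ HA, ∃ T, IsSymbol A T := fun A hA =>
    exists_isSymbol hinf hspc ((hHA' A).1 hA)
  let Φ (A : C₀(ℕ, X) →L[ℂ] C₀(ℕ, X)) : C₀(ℕ, ℂ) →L[ℂ] C₀(ℕ, ℂ) :=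
    if h : ∃ T, IsSymbol A T then h.choose else 0
  have hΦ {A T} (h : IsSymbol A T) : Φ A = T := by
    have h' : ∃ T, IsSymbol A T := ⟨T, h⟩
    simp only [Φ, dif_pos h']
    exact h'.choose_spec.unique hinf h
  have hsym : ∀ A ∈ HA, IsSymbol A (Φ A) := fun A hA => by
    obtain ⟨T, hT⟩ := hex A hA
    rwa [hΦ hT]
  refine ⟨Φ, fun A hA => (hsym A hA).1, fun A hA B hB => ⟨?_, fun c => ?_, ?_⟩,
    fun A hA => (hsym A hA).norm_eq_sInf hinf, fun A hA => ⟨fun h => ?_, fun h => ?_⟩,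
    fun T hT => ⟨ampliation T, ?_, hΦ (.ampliation hT)⟩⟩
  · exact hΦ ((hsym A hA).add (hsym B hB))
  · exact hΦ ((hsym A hA).smul c)
  · exact hΦ ((hsym A hA).comp (hsym B hB))
  · exact IsSymbol.zero_iff.1 (h ▸ hsym A hA)
  · exact hΦ (IsSymbol.zero_iff.2 h)
  · exact (hHA' _).2 (tendsto_proj_comp_ampliation hT)
end

section
/- Let Z be a C-Bourgain-Delbaen-ℒ∞ sum of Banach spaces (X_n). Then the standard Schauder decomposition (Z_n) of Z is C-finitely Fredholm equivalent to the standard Schauder decomposition of (⊕_n X_n)₀, witnessed by the operators L_n : Z → (⊕_n X_n)₀, L_n((x_k,y_k)_k) = (x_1,…,x_n,0,0,…), and R_n : (⊕_n X_n)₀ → Z, R_n((x_k)_k) = i_n((x_1,0),…,(x_n,0)). -/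
open Filter Topology ENNReal

/-- A continuous linear map whose range, viewed in an ambient space, lies in a finite-dimensional
subspace is compact. -/
theorem isCompactOperator_of_coe_mem_finiteDimensional {E W : Type*} [NormedAddCommGroup E]
    [NormedSpace ℂ E] [NormedAddCommGroup W] [NormedSpace ℂ W] {Z : Submodule ℂ W}
    (T : E →L[ℂ] Z) (S : Submodule ℂ W) [FiniteDimensional ℂ S] (h : ∀ x, (T x : W) ∈ S) :
    IsCompactOperator ⇑T := by
  have hfin : FiniteDimensional ℂ (S.comap Z.subtype) :=
    FiniteDimensional.of_injective
      ((Z.subtype.comp (S.comap Z.subtype).subtype).codRestrict S fun x => x.2) (by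
        intro a b hab
        exact Subtype.ext (Subtype.ext (congrArg (fun s : S => (s : W)) hab)))
  have : ProperSpace (S.comap Z.subtype) := FiniteDimensional.proper ℂ _
  exact (isCompactOperator_of_locallyCompactSpace_dom
    (T.codRestrict (S.comap Z.subtype) h)).clm_comp (S.comap Z.subtype).subtypeL

section BoundedSum

variable {X : ℕ → Type*} [∀ n, NormedAddCommGroup (X n)]
  {Δ : ℕ → Type*} [∀ n, Fintype (Δ n)]

/-- The bounded sequences with vanishing `X`-components that are supported on `{0, …, n}`. -/
def finiteScalarPart (X : ℕ → Type*) [∀ n, NormedAddCommGroup (X n)] [∀ n, NormedSpace ℂ (X n)]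
    (Δ : ℕ → Type*) [∀ n, Fintype (Δ n)] (n : ℕ) :
    Submodule ℂ (lp (fun n => X n × (Δ n → ℂ)) ∞) where
  carrier := {w | ∀ k, (w k).1 = 0 ∧ (n < k → w k = 0)}
  add_mem' {a b} ha hb k := by
    refine ⟨by simp [(ha k).1, (hb k).1], fun hk => by simp [(ha k).2 hk, (hb k).2 hk]⟩
  zero_mem' k := by simp
  smul_mem' c a ha k := by
    refine ⟨by simp [(ha k).1], fun hk => by simp [(ha k).2 hk]⟩

instance [∀ n, NormedSpace ℂ (X n)] (n : ℕ) : FiniteDimensional ℂ (finiteScalarPart X Δ n) := by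
  let f : finiteScalarPart X Δ n →ₗ[ℂ] (∀ k : Fin (n + 1), Δ k → ℂ) :=
    { toFun := fun w k => ((w : lp (fun n => X n × (Δ n → ℂ)) ∞) k).2
      map_add' := fun a b => rfl
      map_smul' := fun c a => rfl }
  refine FiniteDimensional.of_injective f fun a b hab => ?_
  refine Subtype.ext (lp.ext (funext fun k => ?_))
  rcases lt_or_ge n k with hk | hk
  · rw [(a.2 k).2 hk, (b.2 k).2 hk]
  · exact Prod.ext ((a.2 k).1.trans (b.2 k).1.symm)
      (congrFun hab (⟨k, Nat.lt_succ_of_le hk⟩ : Fin (n + 1)))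

/-- Truncating a bounded sequence to `{0, …, n}` and padding it with zero scalar parts does not
increase the norm. -/
theorem exists_truncated_lift (Δ : ℕ → Type*) [∀ n, Fintype (Δ n)] (n : ℕ)
    (y : lp (fun n => X n) ∞) :
    ∃ w : lp (fun n => X n × (Δ n → ℂ)) ∞,
      (∀ k, w k = ((if k ≤ n then y k else 0), 0)) ∧ ‖w‖ ≤ ‖y‖ := by
  have hb : ∀ k, ‖(((if k ≤ n then y k else 0), 0) : X k × (Δ k → ℂ))‖ ≤ ‖y‖ := by
    intro k
    rw [Prod.norm_def, norm_zero, max_eq_left (norm_nonneg _)]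
    split_ifs
    · exact lp.norm_apply_le_norm ENNReal.top_ne_zero y k
    · simp
  exact ⟨⟨fun k => ((if k ≤ n then y k else 0), 0),
      memℓp_infty ⟨‖y‖, by rintro _ ⟨k, rfl⟩; exact hb k⟩⟩,
    fun k => rfl, lp.norm_le_of_forall_le (norm_nonneg y) hb⟩

end BoundedSum

/-- Let `Z` be a `C`-Bourgain-Delbaen-`ℒ∞` sum of Banach spaces `(X n)`.
Then the standard Schauder decomposition `(Z_n)` of `Z` (with projections
`P n = i n ∘ ρ n |_Z`) is `C`-finitely Fredholm equivalent to the standard Schauder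
decomposition of `(⊕_n X_n)₀` (with coordinate projections `Q n`), witnessed by
`L n ((x_k, y_k)_k) = (x_1, …, x_n, 0, …)` and `R n ((x_k)_k) = i n ((x_1,0), …, (x_n,0))`. -/
theorem stmt12 (X : ℕ → Type*) [∀ n, NormedAddCommGroup (X n)] [∀ n, NormedSpace ℂ (X n)]
    [∀ n, CompleteSpace (X n)]
    (Δ : ℕ → Type*) [∀ n, Fintype (Δ n)]
    (C : ℝ) (hC : 1 ≤ C)
    (ρ : ℕ → lp (fun n => X n × (Δ n → ℂ)) ∞ →L[ℂ] lp (fun n => X n × (Δ n → ℂ)) ∞)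
    (hρ : ∀ n (w : lp (fun n => X n × (Δ n → ℂ)) ∞) k,
      (ρ n w) k = if k ≤ n then w k else 0)
    (i : ℕ → lp (fun n => X n × (Δ n → ℂ)) ∞ →L[ℂ] lp (fun n => X n × (Δ n → ℂ)) ∞)
    (hiC : ∀ n, ‖i n‖ ≤ C)
    (hloc : ∀ n, (i n).comp (ρ n) = i n)
    (hright : ∀ n w, ρ n (i n w) = ρ n w)
    (hγ : ∀ m n, m ≤ n → (i n).comp ((ρ n).comp (i m)) = i m)
    (hδ : ∀ m n, m < n → ∀ w, ((i m w) n).1 = 0)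
    -- `Z`, as a closed subspace of `W`
    (Z : Submodule ℂ (lp (fun n => X n × (Δ n → ℂ)) ∞))
    (hZ : Z = (Submodule.span ℂ
        (⋃ n, i n '' {w | ∀ k, k ≠ n → w k = 0})).topologicalClosure)
    -- `Y = (⊕_n X_n)₀`, the c₀-sum, as the closed subspace of `(⊕_n X_n)_∞` generated by
    -- the finitely supported elements
    (Y : Submodule ℂ (lp (fun n => X n) ∞))
    (hY : Y = (Submodule.span ℂ
        {f : lp (fun n => X n) ∞ | {n | f n ≠ 0}.Finite}).topologicalClosure)
    -- the projections of the two Schauder decompositions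
    (P : ℕ → Z →L[ℂ] Z) (Q : ℕ → Y →L[ℂ] Y)
    (hP : ∀ n (z : Z), ((P n z : lp (fun n => X n × (Δ n → ℂ)) ∞)) = i n (ρ n (z : lp (fun n => X n × (Δ n → ℂ)) ∞)))
    (hQ : ∀ n (y : Y) k, ((Q n y : lp (fun n => X n) ∞)) k = if k ≤ n then (y : lp (fun n => X n) ∞) k else 0)
    -- the operators L_n and R_n
    (L : ℕ → Z →L[ℂ] Y) (R : ℕ → Y →L[ℂ] Z)
    (hL : ∀ n (z : Z) k, ((L n z : lp (fun n => X n) ∞)) k =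
      if k ≤ n then ((z : lp (fun n => X n × (Δ n → ℂ)) ∞) k).1 else 0)
    (hR : ∀ n (y : Y) (w : lp (fun n => X n × (Δ n → ℂ)) ∞),
      (∀ k, w k = ((if k ≤ n then (y : lp (fun n => X n) ∞) k else 0), 0)) →
      ((R n y : lp (fun n => X n × (Δ n → ℂ)) ∞)) = i n w) :
    -- conclusion: C-finite Fredholm equivalence
    BddAbove (Set.range fun n => ‖L n‖) ∧
    BddAbove (Set.range fun n => ‖R n‖) ∧
    (⨆ n, ‖L n‖) * (⨆ n, ‖R n‖) ≤ C ∧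
    (∀ m n, m ≤ n →
      IsCompactOperator ⇑(L m - (L n).comp (P m)) ∧
      IsCompactOperator ⇑(L m - (Q m).comp (L n)) ∧
      IsCompactOperator ⇑(R m - (R n).comp (Q m)) ∧
      IsCompactOperator ⇑(R m - (P m).comp (R n))) ∧
    (∀ n, IsCompactOperator ⇑((R n).comp (L n) - P n) ∧
      IsCompactOperator ⇑((L n).comp (R n) - Q n)) := by
  have hcoord : ∀ {n k}, k ≤ n → ∀ w, (i n w) k = w k := by
    intro n k hk w
    simpa [hρ, hk] using congrArg (fun v : lp (fun n => X n × (Δ n → ℂ)) ∞ => v k) (hright n w)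
  have hLn : ∀ n, ‖L n‖ ≤ 1 := fun n => by
    refine (L n).opNorm_le_bound zero_le_one fun z => ?_
    rw [one_mul]
    rw [Submodule.coe_norm]
    refine lp.norm_le_of_forall_le (norm_nonneg z) fun k => ?_
    rw [hL]
    split_ifs
    · exact (norm_fst_le _).trans (lp.norm_apply_le_norm ENNReal.top_ne_zero
        (z : lp (fun n => X n × (Δ n → ℂ)) ∞) k)
    · simp
  have hRn : ∀ n, ‖R n‖ ≤ C := fun n => by
    refine (R n).opNorm_le_bound (zero_le_one.trans hC) fun y => ?_
    obtain ⟨w, hw, hwy⟩ := exists_truncated_lift Δ n (y : lp (fun n => X n) ∞)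
    rw [Submodule.coe_norm, hR n y w hw]
    exact (i n).le_of_opNorm_le_of_le (hiC n) hwy
  refine ⟨⟨1, by rintro _ ⟨n, rfl⟩; exact hLn n⟩, ⟨C, by rintro _ ⟨n, rfl⟩; exact hRn n⟩, ?_,
    fun m n hmn => ⟨?_, ?_, ?_, ?_⟩, fun n => ⟨?_, ?_⟩⟩
  · calc (⨆ n, ‖L n‖) * (⨆ n, ‖R n‖) ≤ 1 * C :=
          mul_le_mul (ciSup_le hLn) (ciSup_le hRn) (Real.iSup_nonneg fun n => norm_nonneg (R n))
            zero_le_one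
      _ = C := one_mul C
  · have : L m - (L n).comp (P m) = 0 := by
      refine sub_eq_zero.2 (ContinuousLinearMap.ext fun z =>
        Subtype.ext (lp.ext (funext fun k => ?_)))
      rw [ContinuousLinearMap.comp_apply, hL, hL, hP]
      by_cases hk : k ≤ m
      · rw [if_pos hk, if_pos (hk.trans hmn), hcoord hk, hρ, if_pos hk]
      · rw [if_neg hk, hδ m k (not_le.1 hk), ite_self]
    rw [this]
    exact isCompactOperator_zero
  · have : L m - (Q m).comp (L n) = 0 := by
      refine sub_eq_zero.2 (ContinuousLinearMap.ext fun z =>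
        Subtype.ext (lp.ext (funext fun k => ?_)))
      rw [ContinuousLinearMap.comp_apply, hL, hQ, hL]
      by_cases hk : k ≤ m
      · rw [if_pos hk, if_pos hk, if_pos (hk.trans hmn)]
      · rw [if_neg hk, if_neg hk]
    rw [this]
    exact isCompactOperator_zero
  · refine isCompactOperator_of_coe_mem_finiteDimensional _
      ((finiteScalarPart X Δ n).map (i n).toLinearMap) fun y => ?_
    obtain ⟨w, hw, -⟩ := exists_truncated_lift Δ m (y : lp (fun n => X n) ∞)
    have hRQ : (R n (Q m y) : lp (fun n => X n × (Δ n → ℂ)) ∞) = i n w := by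
      refine hR n (Q m y) w fun k => ?_
      rw [hw, hQ]
      by_cases hk : k ≤ m
      · rw [if_pos hk, if_pos (hk.trans hmn)]
      · rw [if_neg hk, ite_self]
    refine ⟨ρ n (i m w) - w, fun k => ?_, ?_⟩
    · rw [lp.coeFn_sub, Pi.sub_apply, hρ]
      by_cases hk : k ≤ m
      · simp [hk.trans hmn, hcoord hk]
      · have hwk : w k = 0 := by rw [hw, if_neg hk]; rfl
        by_cases hkn : k ≤ n
        · simp [hkn, hwk, hδ m k (not_le.1 hk), not_lt.2 hkn]
        · simp [hkn, hwk]
    · have h := congrArg (fun T => T w) (hγ m n hmn)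
      simp only [ContinuousLinearMap.comp_apply] at h
      rw [map_sub, ContinuousLinearMap.coe_coe, h, sub_apply,
        ContinuousLinearMap.comp_apply, Submodule.coe_sub, hR m y w hw, hRQ]
  · have : R m - (P m).comp (R n) = 0 := by
      refine sub_eq_zero.2 (ContinuousLinearMap.ext fun y => Subtype.ext ?_)
      obtain ⟨w, hw, -⟩ := exists_truncated_lift Δ n (y : lp (fun n => X n) ∞)
      rw [ContinuousLinearMap.comp_apply, hP, hR n y w hw]
      refine hR m y _ fun k => ?_
      rw [hρ]
      by_cases hk : k ≤ m
      · rw [if_pos hk, if_pos hk, hcoord (hk.trans hmn), hw, if_pos (hk.trans hmn)]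
      · rw [if_neg hk, if_neg hk]
        rfl
    rw [this]
    exact isCompactOperator_zero
  · refine isCompactOperator_of_coe_mem_finiteDimensional _
      ((finiteScalarPart X Δ n).map (i n).toLinearMap) fun z => ?_
    obtain ⟨w, hw, -⟩ := exists_truncated_lift Δ n (L n z : lp (fun n => X n) ∞)
    refine ⟨w - ρ n z, fun k => ?_, ?_⟩
    · rw [lp.coeFn_sub, Pi.sub_apply, hw, hρ, hL]
      by_cases hk : k ≤ n
      · simp [hk, not_lt.2 hk]
      · simp [hk]
    · rw [map_sub, ContinuousLinearMap.coe_coe, sub_apply,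
        ContinuousLinearMap.comp_apply, Submodule.coe_sub, hR n (L n z) w hw, hP]
  · have : (L n).comp (R n) - Q n = 0 := by
      refine sub_eq_zero.2 (ContinuousLinearMap.ext fun y =>
        Subtype.ext (lp.ext (funext fun k => ?_)))
      obtain ⟨w, hw, -⟩ := exists_truncated_lift Δ n (y : lp (fun n => X n) ∞)
      rw [ContinuousLinearMap.comp_apply, hL, hQ, hR n y w hw]
      by_cases hk : k ≤ n
      · rw [if_pos hk, if_pos hk, hcoord hk, hw, if_pos hk]
      · rw [if_neg hk, if_neg hk]
    rw [this]
    exact isCompactOperator_zero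
end
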